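/- arXiv:2110.11733 — 4 statements merged into one kernel-verified Lean document; each statement's English description precedes it below -/
import Mathlib

section
/- Let f : ℝ × ℝ → ℝ≥0 be measurable with ∫∫ f(x,y) dx dy = 1. Define the marginal density f₁(x) = ∫ f(x,y) dy, the marginal CDF F₁(x) = ∫_{(-∞,x]} f₁, and for x with f₁(x) > 0 the conditional CDF F₂(y | x) = (∫_{(-∞,y]} f(x, ·)) / f₁(x). Let γ₁, γ₂ be independent random variables uniformly distributed on [0,1], and set ξ₁ = sInf {x | γ₁ ≤ F₁ x} and ξ₂ = sInf {y | γ₂ ≤ F₂ (y | ξ₁)}. Then the joint distribution of (ξ₁, ξ₂) is absolutely continuous with respect to Lebesgue measure on ℝ² with density f. -/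
open MeasureTheory ProbabilityTheory Set Filter Topology

/-- The quantile function of a measure on `ℝ`: the generalized inverse of its cdf. -/
noncomputable def quantile (μ : Measure ℝ) (t : ℝ) : ℝ := sInf {x | t ≤ cdf μ x}

lemma quantile_le_iff (μ : Measure ℝ) {t : ℝ} (ht : t ∈ Ioo 0 1) (x : ℝ) :
    quantile μ t ≤ x ↔ t ≤ cdf μ x := by
  have hne : {x | t ≤ cdf μ x}.Nonempty :=
    (((tendsto_cdf_atTop μ).eventually (lt_mem_nhds ht.2)).exists).imp fun _ h ↦ h.le
  have hbdd : BddBelow {x | t ≤ cdf μ x} := by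
    obtain ⟨a, ha⟩ := ((tendsto_cdf_atBot μ).eventually (gt_mem_nhds ht.1)).exists
    refine ⟨a, fun y hy ↦ ?_⟩
    by_contra! hlt
    exact (hy.trans (monotone_cdf μ hlt.le)).not_gt ha
  refine ⟨fun h ↦ ?_, fun h ↦ csInf_le hbdd h⟩
  refine ge_of_tendsto (continuousWithinAt_Ioi_iff_Ici.mpr ((cdf μ).right_continuous x)) ?_
  filter_upwards [self_mem_nhdsWithin] with y hy
  obtain ⟨z, hz, hzy⟩ := exists_lt_of_csInf_lt hne (h.trans_lt hy)
  exact le_trans hz (monotone_cdf μ hzy.le)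

lemma measurable_indicator_quantile {α : Type*} [MeasurableSpace α] (κ : Kernel α ℝ)
    [IsMarkovKernel κ] :
    Measurable (Function.uncurry fun a ↦ (Ioo (0 : ℝ) 1).indicator (quantile (κ a))) := by
  refine measurable_of_Iic fun y ↦ ?_
  have hcdf : Measurable fun p : α × ℝ ↦ cdf (κ p.1) y := by
    simp_rw [cdf_eq_real, measureReal_def]
    exact ((κ.measurable_coe measurableSet_Iic).comp measurable_fst).ennreal_toReal
  have hset : (Function.uncurry fun a ↦ (Ioo (0 : ℝ) 1).indicator (quantile (κ a))) ⁻¹' Iic y =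
      Set.ite {p : α × ℝ | p.2 ∈ Ioo (0 : ℝ) 1} {p | p.2 ≤ cdf (κ p.1) y} {_p | 0 ≤ y} := by
    ext ⟨a, t⟩
    by_cases ht : t ∈ Ioo (0 : ℝ) 1
    · simp [Set.ite, Function.uncurry, quantile_le_iff _ ht, ht.1, ht.2]
    · have ht' := ht
      simp only [mem_Ioo] at ht'
      simp [Set.ite, Function.uncurry, ht']
  rw [hset]
  exact (measurable_snd measurableSet_Ioo).ite (measurableSet_le measurable_snd hcdf)
    (MeasurableSet.const _)

/-- Inverse-transform sampling. -/
lemma map_indicator_quantile (μ : Measure ℝ) [IsProbabilityMeasure μ] :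
    (volume.restrict (Ioo (0 : ℝ) 1)).map ((Ioo (0 : ℝ) 1).indicator (quantile μ)) = μ := by
  have hm : Measurable ((Ioo (0 : ℝ) 1).indicator (quantile μ)) :=
    (measurable_indicator_quantile (Kernel.const Unit μ)).of_uncurry_left (x := ())
  refine Measure.ext_of_Iic _ _ fun x ↦ ?_
  rw [Measure.map_apply hm measurableSet_Iic,
    Measure.restrict_apply (hm measurableSet_Iic), ← ofReal_cdf μ x]
  have hset : (Ioo (0 : ℝ) 1).indicator (quantile μ) ⁻¹' Iic x ∩ Ioo 0 1 =
      Iic (cdf μ x) ∩ Ioo 0 1 := by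
    ext t
    simp only [mem_inter_iff, mem_preimage, mem_Iic, and_congr_left_iff]
    intro ht
    rw [indicator_of_mem ht, quantile_le_iff μ ht]
  have hIoc : Iic (cdf μ x) ∩ Ioc (0 : ℝ) 1 = Ioc 0 (cdf μ x) := by
    rw [inter_comm, Ioc_inter_Iic, min_eq_right (cdf_le_one μ x)]
  rw [hset, measure_congr ((ae_eq_refl _).inter Ioo_ae_eq_Ioc), hIoc, Real.volume_Ioc, sub_zero]

/-- Sampling first from `μ` and then from `κ` produces the composition product. -/
lemma map_prod_eq_compProd {α β γ δ : Type*} [MeasurableSpace α] [MeasurableSpace β]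
    [MeasurableSpace γ] [MeasurableSpace δ] {ρ : Measure α} {σ : Measure β} [SFinite ρ]
    [SFinite σ] {μ : Measure γ} [SFinite μ] {κ : Kernel γ δ} [IsSFiniteKernel κ]
    {g : α → γ} {h : γ → β → δ} (hg : Measurable g) (hh : Measurable (Function.uncurry h))
    (hμ : ρ.map g = μ) (hκ : ∀ x, σ.map (h x) = κ x) :
    (ρ.prod σ).map (fun p ↦ (g p.1, h (g p.1) p.2)) = μ ⊗ₘ κ := by
  have hm : Measurable fun p : α × β ↦ (g p.1, h (g p.1) p.2) :=
    (hg.comp measurable_fst).prodMk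
      (hh.comp ((hg.comp measurable_fst).prodMk measurable_snd))
  ext s hs
  rw [Measure.map_apply hm hs, Measure.prod_apply (hm hs), Measure.compProd_apply hs, ← hμ,
    lintegral_map (Kernel.measurable_kernel_prodMk_left hs) hg]
  refine lintegral_congr fun a ↦ ?_
  rw [← hκ, Measure.map_apply hh.of_uncurry_left (measurable_prodMk_left hs)]
  rfl

/-- Conditional inverse-transform sampling from a composition product. -/
lemma map_quantile_quantile (μ : Measure ℝ) [IsProbabilityMeasure μ] (κ : Kernel ℝ ℝ)
    [IsMarkovKernel κ] :
    (volume.restrict (Ioo (0 : ℝ) 1 ×ˢ Ioo (0 : ℝ) 1)).map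
      (fun p ↦ (quantile μ p.1, quantile (κ (quantile μ p.1)) p.2)) = μ ⊗ₘ κ := by
  have hm : Measurable ((Ioo (0 : ℝ) 1).indicator (quantile μ)) :=
    (measurable_indicator_quantile (Kernel.const Unit μ)).of_uncurry_left (x := ())
  rw [← map_prod_eq_compProd hm (measurable_indicator_quantile κ)
    (map_indicator_quantile μ) (fun x ↦ map_indicator_quantile (κ x)), Measure.prod_restrict,
    ← Measure.volume_eq_prod]
  refine Measure.map_congr ?_
  filter_upwards [ae_restrict_mem (measurableSet_Ioo.prod measurableSet_Ioo)] with p hp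
  simp [indicator_of_mem hp.1, indicator_of_mem hp.2]

section Disintegration

variable {α β : Type*} [MeasurableSpace α] [MeasurableSpace β]

open Classical in
/-- The kernel whose value at `a` is the probability measure with density `f (a, ·)` with respect
to `ν`, normalized by its total mass `m a`, if `m a` is positive and finite, and the Dirac measure
at `b` otherwise. -/
noncomputable def normalizedKernel (ν : Measure β) [SFinite ν] (b : β) (f : α × β → ENNReal)
    {m : α → ENNReal} (hm : Measurable m) : Kernel α β :=
  Kernel.piecewise (s := m ⁻¹' Ioo 0 ⊤) (hm measurableSet_Ioo)
    ((Kernel.const α ν).withDensity fun a y ↦ (m a)⁻¹ * f (a, y))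
    (Kernel.const α (Measure.dirac b))

variable {ν : Measure β} [SFinite ν] {b : β} {f : α × β → ENNReal} {m : α → ENNReal}

lemma normalizedKernel_apply (hf : Measurable f) (hm : Measurable m) {a : α}
    (ha : m a ∈ Ioo 0 ⊤) {s : Set β} :
    normalizedKernel ν b f hm a s = (m a)⁻¹ * ∫⁻ y in s, f (a, y) ∂ν := by
  classical
  rw [normalizedKernel, Kernel.piecewise_apply, if_pos (show a ∈ m ⁻¹' Ioo 0 ⊤ from ha),
    Kernel.withDensity_apply' _ (by fun_prop), Kernel.const_apply,
    lintegral_const_mul _ (by fun_prop)]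

lemma isMarkovKernel_normalizedKernel (hf : Measurable f) (hm : Measurable m)
    (hmf : ∀ a, m a = ∫⁻ y, f (a, y) ∂ν) : IsMarkovKernel (normalizedKernel ν b f hm) := by
  classical
  refine ⟨fun a ↦ ?_⟩
  by_cases ha : m a ∈ Ioo 0 ⊤
  · refine ⟨?_⟩
    rw [normalizedKernel_apply hf hm ha, Measure.restrict_univ, ← hmf,
      ENNReal.inv_mul_cancel ha.1.ne' ha.2.ne]
  · rw [normalizedKernel, Kernel.piecewise_apply, if_neg (show a ∉ m ⁻¹' Ioo 0 ⊤ from ha),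
      Kernel.const_apply]
    infer_instance

lemma compProd_normalizedKernel {μ : Measure α} [SFinite μ] (hf : Measurable f)
    (hm : Measurable m) (hmf : ∀ a, m a = ∫⁻ y, f (a, y) ∂ν)
    (hfin : ∫⁻ p, f p ∂μ.prod ν ≠ ⊤) :
    μ.withDensity m ⊗ₘ normalizedKernel ν b f hm = (μ.prod ν).withDensity f := by
  have := isMarkovKernel_normalizedKernel (b := b) hf hm hmf
  have hmass : ∫⁻ a, m a ∂μ = ∫⁻ p, f p ∂μ.prod ν := by
    simp_rw [hmf, lintegral_prod _ hf.aemeasurable]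
  have : IsFiniteMeasure (μ.withDensity m) := isFiniteMeasure_withDensity (hmass ▸ hfin)
  refine Measure.ext_prod fun {s t} hs ht ↦ ?_
  rw [Measure.compProd_apply_prod hs ht, withDensity_apply _ (hs.prod ht),
    ← Measure.prod_restrict, lintegral_prod _ hf.aemeasurable, restrict_withDensity hs,
    lintegral_withDensity_eq_lintegral_mul _ hm (Kernel.measurable_coe _ ht)]
  refine lintegral_congr_ae (ae_restrict_of_ae ?_)
  filter_upwards [ae_lt_top hm (hmass ▸ hfin)] with a ha
  rcases eq_zero_or_pos (m a) with h0 | hpos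
  · have hle : ∫⁻ y in t, f (a, y) ∂ν ≤ m a := (hmf a).symm ▸ setLIntegral_le_lintegral _ _
    simp only [Pi.mul_apply, h0, zero_mul]
    exact (le_antisymm (h0 ▸ hle) zero_le).symm
  · rw [Pi.mul_apply, normalizedKernel_apply hf hm ⟨hpos, ha⟩, ← mul_assoc,
      ENNReal.mul_inv_cancel hpos.ne' ha.ne, one_mul]

end Disintegration

/-- **Conditional inverse-transform sampling** (Lemma 2): if `f` is a joint probability
density on `ℝ²` with first marginal density `f₁`, marginal CDF `F₁`, conditional CDF
`F₂ (· | x)`, and `γ₁, γ₂` are independent uniforms on `[0,1]`, then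
`(ξ₁, ξ₂) = (sInf {x | γ₁ ≤ F₁ x}, sInf {y | γ₂ ≤ F₂ (y | ξ₁)})` has joint density `f`. -/
theorem conditional_inverse_transform_sampling
    (f : ℝ × ℝ → NNReal) (hf : Measurable f)
    (hnorm : ∫⁻ p : ℝ × ℝ, (f p : ENNReal) = 1)
    (f₁ : ℝ → ENNReal) (hf₁ : ∀ x, f₁ x = ∫⁻ y : ℝ, (f (x, y) : ENNReal))
    (F₁ : ℝ → ℝ) (hF₁ : ∀ x, F₁ x = (∫⁻ t in Set.Iic x, f₁ t).toReal)
    (F₂ : ℝ → ℝ → ℝ)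
    (hF₂ : ∀ x y, 0 < f₁ x →
      F₂ x y = (∫⁻ t in Set.Iic y, (f (x, t) : ENNReal)).toReal / (f₁ x).toReal)
    (ξ₁ : ℝ × ℝ → ℝ) (hξ₁ : ∀ γ : ℝ × ℝ, ξ₁ γ = sInf {x : ℝ | γ.1 ≤ F₁ x})
    (ξ₂ : ℝ × ℝ → ℝ) (hξ₂ : ∀ γ : ℝ × ℝ, ξ₂ γ = sInf {y : ℝ | γ.2 ≤ F₂ (ξ₁ γ) y}) :
    Measure.map (fun γ : ℝ × ℝ => (ξ₁ γ, ξ₂ γ))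
      (volume.restrict (Set.Icc (0:ℝ) 1 ×ˢ Set.Icc (0:ℝ) 1))
    = volume.withDensity (fun p : ℝ × ℝ => (f p : ENNReal)) := by
  set g : ℝ × ℝ → ENNReal := fun p ↦ f p
  have hg : Measurable g := hf.coe_nnreal_ennreal
  have hm : Measurable f₁ := (funext hf₁) ▸ hg.lintegral_prod_right'
  have hmass : ∫⁻ x, f₁ x = 1 := by
    simp_rw [hf₁, ← hnorm, Measure.volume_eq_prod, lintegral_prod _ hg.aemeasurable, g]
  set μ : Measure ℝ := volume.withDensity f₁
  set κ : Kernel ℝ ℝ := normalizedKernel volume 0 g hm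
  have hμ : IsProbabilityMeasure μ :=
    ⟨by rw [withDensity_apply _ .univ, Measure.restrict_univ, hmass]⟩
  have hκ : IsMarkovKernel κ := isMarkovKernel_normalizedKernel hg hm hf₁
  have hξμ (γ : ℝ × ℝ) : ξ₁ γ = quantile μ γ.1 := by
    simp_rw [hξ₁, quantile, cdf_eq_real, measureReal_def, hF₁, μ,
      withDensity_apply _ measurableSet_Iic]
  have hξκ (γ : ℝ × ℝ) (h : f₁ (ξ₁ γ) ∈ Ioo 0 ⊤) :
      ξ₂ γ = quantile (κ (quantile μ γ.1)) γ.2 := by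
    simp_rw [hξ₂, ← hξμ, quantile, cdf_eq_real, measureReal_def, hF₂ _ _ h.1, κ,
      normalizedKernel_apply hg hm h, ENNReal.toReal_mul, ENNReal.toReal_inv, div_eq_inv_mul, g]
  have hμpos : ∀ᵐ x ∂μ, f₁ x ∈ Ioo 0 ⊤ := by
    rw [ae_withDensity_iff hm]
    filter_upwards [ae_lt_top hm (hmass ▸ ENNReal.one_ne_top)] with x hx h0
    exact ⟨pos_iff_ne_zero.mpr h0, hx⟩
  have hmap := map_quantile_quantile μ κ
  have hmeas : AEMeasurable (fun p : ℝ × ℝ ↦ (quantile μ p.1, quantile (κ (quantile μ p.1)) p.2))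
      (volume.restrict (Ioo (0 : ℝ) 1 ×ˢ Ioo (0 : ℝ) 1)) :=
    AEMeasurable.of_map_ne_zero (hmap ▸ NeZero.ne _)
  have hpos : ∀ᵐ γ ∂volume.restrict (Ioo (0 : ℝ) 1 ×ˢ Ioo (0 : ℝ) 1),
      f₁ (quantile μ γ.1) ∈ Ioo 0 ⊤ := by
    refine ae_of_ae_map (p := fun q : ℝ × ℝ ↦ f₁ q.1 ∈ Ioo 0 ⊤) hmeas ?_
    rw [hmap]
    refine ae_of_ae_map (p := fun x ↦ f₁ x ∈ Ioo 0 ⊤) measurable_fst.aemeasurable ?_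
    change ∀ᵐ x ∂(μ ⊗ₘ κ).fst, _
    rwa [Measure.fst_compProd]
  have hsq : (Icc (0 : ℝ) 1 ×ˢ Icc (0 : ℝ) 1 : Set (ℝ × ℝ)) =ᵐ[volume]
      (Ioo (0 : ℝ) 1 ×ˢ Ioo (0 : ℝ) 1 : Set (ℝ × ℝ)) :=
    Measure.set_prod_ae_eq Ioo_ae_eq_Icc.symm Ioo_ae_eq_Icc.symm
  rw [Measure.restrict_congr_set hsq, Measure.volume_eq_prod,
    ← compProd_normalizedKernel (b := 0) hg hm hf₁
      (by rw [← Measure.volume_eq_prod, hnorm]; exact ENNReal.one_ne_top),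
    ← Measure.volume_eq_prod]
  refine Eq.trans (Measure.map_congr ?_) hmap
  filter_upwards [hpos] with γ hγ
  rw [hξμ, hξκ γ (by rwa [hξμ])]
end

section
/- For the unit vector Ψ = (e^{−iα/2} sin(θ/2) cos(φ/2), e^{iβ/2} cos(θ/2), e^{iα/2} sin(θ/2) sin(φ/2)) ∈ ℂ³ and the operator P⁺ = (1/2)(S₊ + T₊) with T₊ = S_z S₊ + S₊ S_z, the quantum expectation value satisfies ⟨Ψ, P⁺ Ψ⟩ = (1/2) e^{i(α+β)/2} sin θ cos(φ/2). -/
open Matrix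

/-- The pseudospin matrix `S_z = diag(1,0,−1)`. -/
noncomputable def Sz : Matrix (Fin 3) (Fin 3) ℂ := !![1, 0, 0; 0, 0, 0; 0, 0, -1]

/-- The pseudospin raising matrix `S₊`. -/
noncomputable def Sp : Matrix (Fin 3) (Fin 3) ℂ := !![0, 1, 0; 0, 0, 1; 0, 0, 0]

/-- `T₊ = S_z S₊ + S₊ S_z`. -/
noncomputable def Tp : Matrix (Fin 3) (Fin 3) ℂ := Sz * Sp + Sp * Sz

/-- The quasi-classical on-site wave function of the charge triplet. -/
noncomputable def Psi (θ φ α β : ℝ) : Fin 3 → ℂ :=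
  ![Complex.exp (-Complex.I * α / 2) * Real.sin (θ / 2) * Real.cos (φ / 2),
    Complex.exp (Complex.I * β / 2) * Real.cos (θ / 2),
    Complex.exp (Complex.I * α / 2) * Real.sin (θ / 2) * Real.sin (φ / 2)]

/-- The quantum expectation value `⟨v, A v⟩` (standard Hermitian inner product). -/
noncomputable def expVal {n : Type*} [Fintype n] (A : Matrix n n ℂ) (v : n → ℂ) : ℂ :=
  star v ⬝ᵥ A.mulVec v

/-- `P⁺ = (1/2)(S₊ + T₊)` is the matrix unit `|+1⟩⟨0|`. -/
lemma Pplus_eq : (1 / 2 : ℂ) • (Sp + Tp) = !![0, 1, 0; 0, 0, 0; 0, 0, 0] := by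
  ext i j
  fin_cases i <;> fin_cases j <;> norm_num [Sp, Tp, Sz, Matrix.mul_apply, Fin.sum_univ_three]

/-- `⟨Ψ, P⁺ Ψ⟩ = (1/2) e^{i(α+β)/2} sin θ cos(φ/2)` where `P⁺ = (1/2)(S₊ + T₊)`. -/
theorem expVal_Pplus (θ φ α β : ℝ) (hθ : θ ∈ Set.Icc 0 Real.pi)
    (hφ : φ ∈ Set.Icc 0 Real.pi) :
    expVal ((1 / 2 : ℂ) • (Sp + Tp)) (Psi θ φ α β) =
      Complex.exp (Complex.I * (α + β) / 2) *
        ((Real.sin θ * Real.cos (φ / 2) / 2 : ℝ) : ℂ) := by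
  have hexp : star (Complex.exp (-Complex.I * α / 2)) = Complex.exp (Complex.I * α / 2) := by
    rw [Complex.star_def, ← Complex.exp_conj]
    simp [Complex.conj_ofNat]
  have hsin : Real.sin θ = 2 * Real.sin (θ / 2) * Real.cos (θ / 2) := by
    rw [← Real.sin_two_mul, mul_div_cancel₀ θ two_ne_zero]
  have hval : expVal ((1 / 2 : ℂ) • (Sp + Tp)) (Psi θ φ α β) =
      star (Psi θ φ α β 0) * Psi θ φ α β 1 := by
    rw [Pplus_eq]
    simp [expVal, dotProduct, mulVec, Fin.sum_univ_three]
  have hconj : star (Psi θ φ α β 0) =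
      Complex.exp (Complex.I * α / 2) * Real.sin (θ / 2) * Real.cos (φ / 2) := by
    simp only [Psi, cons_val_zero, star_mul', hexp, Complex.star_def, Complex.conj_ofReal]
  have hadd : Complex.exp (Complex.I * (α + β) / 2) =
      Complex.exp (Complex.I * α / 2) * Complex.exp (Complex.I * β / 2) := by
    rw [← Complex.exp_add]
    ring_nf
  rw [hval, hconj, hadd, hsin]
  simp only [Psi, cons_val_one, cons_val_zero]
  push_cast
  ring
end

section
/- Let Ψ₁, Ψ₂ ∈ ℂ³ be the unit vectors parameterized by (θ₁, φ₁, α₁, β₁) and (θ₂, φ₂, α₂, β₂). Then the two-site expectation value of the composite-boson transfer operator satisfies ⟨Ψ₁ ⊗ Ψ₂, (S₊² ⊗ S₋² + S₋² ⊗ S₊²)(Ψ₁ ⊗ Ψ₂)⟩ = (1/8)(1 − cos θ₁)(1 − cos θ₂) sin φ₁ sin φ₂ cos(α₁ − α₂). -/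
open Matrix Kronecker

/-- The Kronecker (tensor) product of two on-site state vectors. -/
noncomputable def tens {m n : Type*} (v : m → ℂ) (w : n → ℂ) : m × n → ℂ :=
  fun p => v p.1 * w p.2

theorem expVal_add {n : Type*} [Fintype n] (A B : Matrix n n ℂ) (v : n → ℂ) :
    expVal (A + B) v = expVal A v + expVal B v := by
  simp only [expVal, Matrix.add_mulVec, dotProduct_add]

/-- Expectation values in a product state factor over a Kronecker product. -/
theorem expVal_kronecker_tens {m n : Type*} [Fintype m] [Fintype n] (A : Matrix m m ℂ)
    (B : Matrix n n ℂ) (v : m → ℂ) (w : n → ℂ) :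
    expVal (A ⊗ₖ B) (tens v w) = expVal A v * expVal B w := by
  simp only [expVal, dotProduct, Matrix.mulVec, tens, Pi.star_apply, Matrix.kroneckerMap_apply,
    Fintype.sum_prod_type, star_mul']
  rw [Finset.sum_mul_sum]
  refine Finset.sum_congr rfl fun i _ => Finset.sum_congr rfl fun j _ => ?_
  rw [mul_mul_mul_comm, Finset.sum_mul_sum]
  congr 1
  exact Finset.sum_congr rfl fun k _ => Finset.sum_congr rfl fun l _ => mul_mul_mul_comm _ _ _ _

theorem expVal_Sp_sq (v : Fin 3 → ℂ) : expVal (Sp * Sp) v = star (v 0) * v 2 := by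
  simp [expVal, Sp, dotProduct, Matrix.mulVec, Matrix.mul_apply, Fin.sum_univ_three]

theorem expVal_Sp_transpose_sq (v : Fin 3 → ℂ) :
    expVal (Sp.transpose * Sp.transpose) v = star (v 2) * v 0 := by
  simp [expVal, Sp, dotProduct, Matrix.mulVec, Matrix.mul_apply, Fin.sum_univ_three]

theorem star_Psi_zero_mul_Psi_two (θ φ α β : ℝ) :
    star (Psi θ φ α β 0) * Psi θ φ α β 2 =
      Complex.exp (α * Complex.I) * (((1 - Real.cos θ) * Real.sin φ / 4 : ℝ) : ℂ) := by
  have hamp : (1 - Real.cos θ) * Real.sin φ / 4 =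
      Real.sin (θ / 2) * Real.cos (φ / 2) * (Real.sin (θ / 2) * Real.sin (φ / 2)) := by
    have hθ : Real.cos θ = 1 - 2 * Real.sin (θ / 2) ^ 2 := by
      have h := Real.cos_two_mul' (θ / 2)
      rw [mul_div_cancel₀ θ two_ne_zero] at h
      linarith [Real.cos_sq_add_sin_sq (θ / 2)]
    have hφ : Real.sin φ = 2 * Real.sin (φ / 2) * Real.cos (φ / 2) := by
      rw [← Real.sin_two_mul, mul_div_cancel₀ φ two_ne_zero]
    rw [hθ, hφ]
    ring
  have hphase : star (Complex.exp (-Complex.I * α / 2)) * Complex.exp (Complex.I * α / 2) =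
      Complex.exp (α * Complex.I) := by
    rw [Complex.star_def, ← Complex.exp_conj, ← Complex.exp_add]
    congr 1
    simp only [map_div₀, map_mul, map_neg, Complex.conj_I, Complex.conj_ofReal, map_ofNat]
    ring
  rw [hamp, ← hphase]
  simp only [Psi, Matrix.cons_val, star_mul', Complex.star_def, Complex.conj_ofReal]
  push_cast
  ring

theorem star_Psi_two_mul_Psi_zero (θ φ α β : ℝ) :
    star (Psi θ φ α β 2) * Psi θ φ α β 0 =
      Complex.exp (-α * Complex.I) * (((1 - Real.cos θ) * Real.sin φ / 4 : ℝ) : ℂ) := by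
  have h := congrArg star (star_Psi_zero_mul_Psi_two θ φ α β)
  rw [star_mul, star_star, star_mul'] at h
  rw [h]
  simp only [Complex.star_def, Complex.conj_ofReal, ← Complex.exp_conj, map_mul, Complex.conj_I]
  rw [mul_neg, neg_mul]

/-- Two-site composite-boson transfer expectation:
`⟨Ψ₁ ⊗ Ψ₂, (S₊² ⊗ S₋² + S₋² ⊗ S₊²)(Ψ₁ ⊗ Ψ₂)⟩
  = (1/8)(1 − cos θ₁)(1 − cos θ₂) sin φ₁ sin φ₂ cos(α₁ − α₂)`. -/
theorem expVal_boson_transfer (θ₁ φ₁ α₁ β₁ θ₂ φ₂ α₂ β₂ : ℝ) :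
    expVal ((Sp * Sp) ⊗ₖ (Sp.transpose * Sp.transpose) +
        (Sp.transpose * Sp.transpose) ⊗ₖ (Sp * Sp))
      (tens (Psi θ₁ φ₁ α₁ β₁) (Psi θ₂ φ₂ α₂ β₂)) =
      (((1 - Real.cos θ₁) * (1 - Real.cos θ₂) * Real.sin φ₁ * Real.sin φ₂ *
        Real.cos (α₁ - α₂) / 8 : ℝ) : ℂ) := by
  rw [expVal_add, expVal_kronecker_tens, expVal_kronecker_tens]
  simp only [expVal_Sp_sq, expVal_Sp_transpose_sq, star_Psi_zero_mul_Psi_two,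
    star_Psi_two_mul_Psi_zero]
  have hcos : (Real.cos (α₁ - α₂) : ℂ) =
      (Complex.exp (α₁ * Complex.I) * Complex.exp (-α₂ * Complex.I) +
        Complex.exp (-α₁ * Complex.I) * Complex.exp (α₂ * Complex.I)) / 2 := by
    rw [Complex.ofReal_cos, Complex.cos, ← Complex.exp_add, ← Complex.exp_add]
    push_cast
    ring_nf
  simp only [Complex.ofReal_div, Complex.ofReal_mul, hcos]
  push_cast
  ring
end

section
/- Let Ψ₁, Ψ₂ ∈ ℂ³ be the unit vectors parameterized by (θ₁, φ₁, α₁, β₁) and (θ₂, φ₂, α₂, β₂), with θ_i ∈ [0, π], φ_i ∈ [0, π]. With N⁺ = (1/2)(S₊ − T₊), N = (N⁺)^†, the two-site expectation of the N-type one-particle transfer satisfies ⟨Ψ₁ ⊗ Ψ₂, (N⁺ ⊗ N + N ⊗ N⁺)(Ψ₁ ⊗ Ψ₂)⟩ = (1/2) sin θ₁ sin θ₂ sin(φ₁/2) sin(φ₂/2) cos((α₁ − α₂ − β₁ + β₂)/2). -/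
open Matrix Kronecker

theorem expVal_conjTranspose {n : Type*} [Fintype n] (A : Matrix n n ℂ) (v : n → ℂ) :
    expVal Aᴴ v = star (expVal A v) := by
  rw [expVal, expVal, Matrix.star_dotProduct, Matrix.star_mulVec, ← Matrix.dotProduct_mulVec,
    conjTranspose_conjTranspose]

/-- The matrix `N⁺` is the matrix unit from the third basis state to the second. -/
theorem half_smul_Sp_sub_Tp :
    (1 / 2 : ℂ) • (Sp - Tp) = !![0, 0, 0; 0, 0, 1; 0, 0, 0] := by
  ext i j
  fin_cases i <;> fin_cases j <;> norm_num [Sp, Tp, Sz, Matrix.mul_apply, Fin.sum_univ_three]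

theorem expVal_half_smul_Sp_sub_Tp_Psi (θ φ α β : ℝ) :
    expVal ((1 / 2 : ℂ) • (Sp - Tp)) (Psi θ φ α β) =
      ((Real.sin θ * Real.sin (φ / 2) / 2 : ℝ) : ℂ) *
        Complex.exp (((α - β) / 2 : ℝ) * Complex.I) := by
  have hs : Real.sin θ = 2 * Real.sin (θ / 2) * Real.cos (θ / 2) := by
    rw [← Real.sin_two_mul]
    ring_nf
  have he : Complex.exp (((α - β) / 2 : ℝ) * Complex.I) =
      star (Complex.exp (Complex.I * β / 2)) * Complex.exp (Complex.I * α / 2) := by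
    rw [Complex.star_def, ← Complex.exp_conj, ← Complex.exp_add]
    congr 1
    simp only [map_div₀, map_mul, Complex.conj_I, Complex.conj_ofReal, map_ofNat]
    push_cast
    ring
  rw [half_smul_Sp_sub_Tp, hs, he]
  simp [expVal, Psi, dotProduct, mulVec, Fin.sum_univ_three, -Complex.ofReal_sin,
    -Complex.ofReal_cos, -Complex.ofReal_div]
  push_cast
  ring

/-- The `N`-type one-particle transfer expectation, where `N⁺ = (1/2)(S₊ − T₊)` and
`N = (N⁺)ᴴ`:
`⟨Ψ₁ ⊗ Ψ₂, (N⁺ ⊗ N + N ⊗ N⁺)(Ψ₁ ⊗ Ψ₂)⟩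
  = (1/2) sin θ₁ sin θ₂ sin(φ₁/2) sin(φ₂/2) cos((α₁ − α₂ − β₁ + β₂)/2)`. -/
theorem expVal_N_transfer (θ₁ φ₁ α₁ β₁ θ₂ φ₂ α₂ β₂ : ℝ)
    (hθ₁ : θ₁ ∈ Set.Icc 0 Real.pi) (hφ₁ : φ₁ ∈ Set.Icc 0 Real.pi)
    (hθ₂ : θ₂ ∈ Set.Icc 0 Real.pi) (hφ₂ : φ₂ ∈ Set.Icc 0 Real.pi) :
    expVal (((1 / 2 : ℂ) • (Sp - Tp)) ⊗ₖ ((1 / 2 : ℂ) • (Sp - Tp))ᴴ +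
        ((1 / 2 : ℂ) • (Sp - Tp))ᴴ ⊗ₖ ((1 / 2 : ℂ) • (Sp - Tp)))
      (tens (Psi θ₁ φ₁ α₁ β₁) (Psi θ₂ φ₂ α₂ β₂)) =
      ((Real.sin θ₁ * Real.sin θ₂ * Real.sin (φ₁ / 2) * Real.sin (φ₂ / 2) *
        Real.cos ((α₁ - α₂ - β₁ + β₂) / 2) / 2 : ℝ) : ℂ) := by
  rw [expVal_add, expVal_kronecker_tens, expVal_kronecker_tens, expVal_conjTranspose,
    expVal_conjTranspose, expVal_half_smul_Sp_sub_Tp_Psi, expVal_half_smul_Sp_sub_Tp_Psi]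
  have h : (α₁ - α₂ - β₁ + β₂) / 2 = (α₁ - β₁) / 2 - (α₂ - β₂) / 2 := by ring
  rw [h, Real.cos_sub]
  apply Complex.ext
  · simp [Complex.exp_ofReal_mul_I_re, Complex.exp_ofReal_mul_I_im, -Complex.ofReal_sin,
      -Complex.ofReal_cos, -Complex.ofReal_div, -Complex.ofReal_mul, -Complex.ofReal_sub]
    ring
  · simp [Complex.exp_ofReal_mul_I_re, Complex.exp_ofReal_mul_I_im, -Complex.ofReal_sin,
      -Complex.ofReal_cos, -Complex.ofReal_div, -Complex.ofReal_mul, -Complex.ofReal_sub]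
    ring
end
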